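/- arXiv:math/0208235 — 3 statements merged into one kernel-verified Lean document; each statement's English description precedes it below -/
import Mathlib

section
/- Let G be a group acting on a set X, and let Iⁿ(X) denote the n-fold iterate of the inertia construction (with the inertia G-action at each stage). Then for every n ≥ 0 there is a G-equivariant bijection between Iⁿ(X) and the set {(g, x) : g : Fin n → G, x ∈ X, ∀ i, gᵢ·x = x, and ∀ i j, gᵢ gⱼ = gⱼ gᵢ}, where G acts on the latter set by h·(g, x) = ((h g₁ h⁻¹, …, h gₙ h⁻¹), h·x). -/
universe u

/-- The inertia set of a `G`-set `X`: pairs `(g, x)` with `g • x = x`. -/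
def InertiaSet (G : Type u) [Group G] (X : Type u) [MulAction G X] : Type u :=
  {p : G × X // p.1 • p.2 = p.2}

/-- `G` acts on the inertia set by `h • (g, x) = (h g h⁻¹, h • x)`. -/
instance InertiaSet.instMulAction (G : Type u) [Group G] (X : Type u) [MulAction G X] :
    MulAction G (InertiaSet G X) where
  smul h p := ⟨(h * p.1.1 * h⁻¹, h • p.1.2), by
    rw [mul_smul, mul_smul, inv_smul_smul, p.2]⟩
  one_smul p := Subtype.ext (by
    show ((1 : G) * p.1.1 * (1 : G)⁻¹, (1 : G) • p.1.2) = p.1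
    simp)
  mul_smul a b p := Subtype.ext (by
    show ((a * b) * p.1.1 * (a * b)⁻¹, (a * b) • p.1.2)
      = (a * (b * p.1.1 * b⁻¹) * a⁻¹, a • b • p.1.2)
    rw [mul_smul]
    congr 1
    group)

/-- The iterated inertia construction, carrying its `G`-action at each stage:
`I⁰(X) = X` and `Iⁿ⁺¹(X) = I(Iⁿ(X))`. -/
def IterInertiaData (G : Type u) [grp : Group G] (X : Type u) [m : MulAction G X] :
    ℕ → (T : Type u) × MulAction G T
  | 0 => ⟨X, m⟩
  | n + 1 =>
    ⟨@InertiaSet G grp (IterInertiaData G X n).1 (IterInertiaData G X n).2,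
      @InertiaSet.instMulAction G grp (IterInertiaData G X n).1 (IterInertiaData G X n).2⟩

/-- The `n`-fold iterated inertia set `Iⁿ(X)`. -/
def IterInertia (G : Type u) [Group G] (X : Type u) [MulAction G X] (n : ℕ) : Type u :=
  (IterInertiaData G X n).1

instance (G : Type u) [Group G] (X : Type u) [MulAction G X] (n : ℕ) :
    MulAction G (IterInertia G X n) :=
  (IterInertiaData G X n).2

/-- The set of pairs `(g, x)` where `g : Fin n → G` is a commuting `n`-tuple each of whose
entries fixes `x`. -/
def CommFix (G : Type u) [Group G] (X : Type u) [MulAction G X] (n : ℕ) : Type u :=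
  {q : (Fin n → G) × X //
    (∀ i j, q.1 i * q.1 j = q.1 j * q.1 i) ∧ ∀ i, q.1 i • q.2 = q.2}

/-- `G` acts on `CommFix` by simultaneous conjugation on the tuple and the given action
on the point: `h • (g, x) = ((h gᵢ h⁻¹)ᵢ, h • x)`. -/
instance CommFix.instMulAction (G : Type u) [Group G] (X : Type u) [MulAction G X] (n : ℕ) :
    MulAction G (CommFix G X n) where
  smul h q := ⟨(fun i => h * q.1.1 i * h⁻¹, h • q.1.2), by
    obtain ⟨hc, hfix⟩ := q.2
    refine ⟨fun i j => ?_, fun i => ?_⟩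
    · have key : ∀ a b : G, (h * a * h⁻¹) * (h * b * h⁻¹) = h * (a * b) * h⁻¹ := by
        intro a b; group
      rw [key, key, hc i j]
    · show (h * q.1.1 i * h⁻¹) • (h • q.1.2) = h • q.1.2
      rw [mul_smul, mul_smul, inv_smul_smul, hfix i]⟩
  one_smul q := Subtype.ext (by
    show ((fun i => (1 : G) * q.1.1 i * (1 : G)⁻¹, (1 : G) • q.1.2) : (Fin n → G) × X) = q.1
    simp)
  mul_smul a b q := Subtype.ext (by
    show ((fun i => (a * b) * q.1.1 i * (a * b)⁻¹, (a * b) • q.1.2) : (Fin n → G) × X)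
      = (fun i => a * (b * q.1.1 i * b⁻¹) * a⁻¹, a • b • q.1.2)
    rw [mul_smul]
    refine Prod.ext ?_ rfl
    funext i
    group)

/-- An equivariant bijection of `G`-sets induces a bijection of inertia sets. -/
def InertiaSet.congr {G X Y : Type u} [Group G] [MulAction G X] [MulAction G Y]
    (e : X ≃ Y) (he : ∀ (h : G) (x : X), e (h • x) = h • e x) :
    InertiaSet G X ≃ InertiaSet G Y :=
  ((Equiv.refl G).prodCongr e).subtypeEquiv fun p => by
    show p.1 • p.2 = p.2 ↔ p.1 • e p.2 = e p.2
    rw [← he, e.apply_eq_iff_eq]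

theorem InertiaSet.congr_smul {G X Y : Type u} [Group G] [MulAction G X] [MulAction G Y]
    (e : X ≃ Y) (he : ∀ (h : G) (x : X), e (h • x) = h • e x) (h : G) (p : InertiaSet G X) :
    congr e he (h • p) = h • congr e he p :=
  Subtype.ext (Prod.ext rfl (he h p.1.2))

/-- A commuting `0`-tuple fixing a point is just that point. -/
def CommFix.equivZero (G X : Type u) [Group G] [MulAction G X] : X ≃ CommFix G X 0 where
  toFun x := ⟨(Fin.elim0, x), fun i => i.elim0, fun i => i.elim0⟩
  invFun q := q.1.2
  left_inv _ := rfl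
  right_inv _ := Subtype.ext (Prod.ext (Subsingleton.elim _ _) rfl)

theorem CommFix.equivZero_smul {G X : Type u} [Group G] [MulAction G X] (h : G) (x : X) :
    equivZero G X (h • x) = h • equivZero G X x :=
  Subtype.ext (Prod.ext (Subsingleton.elim _ _) rfl)

/-- An element fixes a point of `CommFix G X n` if and only if it commutes with the tuple and
fixes the underlying point of `X`. -/
theorem CommFix.smul_eq_self_iff {G X : Type u} [Group G] [MulAction G X] {n : ℕ}
    (g : G) (q : CommFix G X n) :
    g • q = q ↔ (∀ i, g * q.1.1 i = q.1.1 i * g) ∧ g • q.1.2 = q.1.2 :=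
  Subtype.ext_iff.trans <| Prod.ext_iff.trans <|
    and_congr_left' <| funext_iff.trans <| forall_congr' fun _ => mul_inv_eq_iff_eq_mul

/-- Prepending an element to a tuple identifies the inertia set of `CommFix G X n` with
`CommFix G X (n + 1)`. -/
def CommFix.equivSucc (G X : Type u) [Group G] [MulAction G X] (n : ℕ) :
    InertiaSet G (CommFix G X n) ≃ CommFix G X (n + 1) where
  toFun p := ⟨(Fin.cons p.1.1 p.1.2.1.1, p.1.2.1.2), by
    obtain ⟨⟨g, q⟩, hp⟩ := p
    obtain ⟨hcomm, hfix⟩ := (smul_eq_self_iff g q).1 hp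
    refine ⟨fun i j => ?_, fun i => ?_⟩
    · cases i using Fin.cases <;> cases j using Fin.cases <;>
        simp [hcomm, q.2.1 _ _]
    · cases i using Fin.cases
      · exact hfix
      · exact q.2.2 _⟩
  invFun q := ⟨(q.1.1 0, ⟨(Fin.tail q.1.1, q.1.2),
      fun i j => q.2.1 i.succ j.succ, fun i => q.2.2 i.succ⟩),
    (smul_eq_self_iff _ _).2 ⟨fun i => q.2.1 0 i.succ, q.2.2 0⟩⟩
  left_inv _ := rfl
  right_inv q := Subtype.ext (Prod.ext (Fin.cons_self_tail q.1.1) rfl)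

theorem CommFix.equivSucc_smul {G X : Type u} [Group G] [MulAction G X] {n : ℕ} (h : G)
    (p : InertiaSet G (CommFix G X n)) :
    equivSucc G X n (h • p) = h • equivSucc G X n p := by
  refine Subtype.ext (Prod.ext (funext fun i => ?_) rfl)
  cases i using Fin.cases <;> rfl

/-- For every `n`, the `n`-fold iterated inertia set `Iⁿ(X)` is `G`-equivariantly in
bijection with the set of pairs `(g, x)` where `g` is a commuting `n`-tuple in `G`
fixing `x`, with `G` acting by simultaneous conjugation on `g` and the given action
on `x`. -/
theorem iterInertia_equiv_commFix (G : Type u) [Group G] (X : Type u) [MulAction G X] :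
    ∀ n : ℕ, ∃ e : IterInertia G X n ≃ CommFix G X n,
      ∀ (h : G) (p : IterInertia G X n), e (h • p) = h • e p := by
  intro n
  induction n with
  | zero => exact ⟨CommFix.equivZero G X, CommFix.equivZero_smul⟩
  | succ n ih =>
    obtain ⟨e, he⟩ := ih
    refine ⟨(InertiaSet.congr e he).trans (CommFix.equivSucc G X n), fun h p => ?_⟩
    exact (congrArg _ (InertiaSet.congr_smul e he h p)).trans (CommFix.equivSucc_smul h _)
end

section
/- Let p be a prime, n ≥ 0, and let G be a finite group with the discrete topology. Evaluation at the standard basis vectors gives a bijection between the set of continuous group homomorphisms from ℤₚⁿ (the n-fold product of the p-adic integers, written multiplicatively) to G and the set of commuting n-tuples (g₁, …, gₙ) in G all of whose entries have p-power order. This bijection is equivariant for the conjugation actions of G. -/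
namespace PadicInt

variable {p : ℕ} [Fact p.Prime]

theorem isLocallyConstant_toZModPow (k : ℕ) :
    IsLocallyConstant (toZModPow k : ℤ_[p] → ZMod (p ^ k)) := by
  rw [IsLocallyConstant.iff_eventually_eq]
  intro x
  have hp : (0 : ℝ) < (p : ℝ) ^ (-k : ℤ) :=
    zpow_pos (by exact_mod_cast (Fact.out : p.Prime).pos) _
  filter_upwards [Metric.ball_mem_nhds x hp] with y hy
  rw [← sub_eq_zero, ← map_sub, ← RingHom.mem_ker, ker_toZModPow, ← norm_le_pow_iff_mem_span_pow,
    ← dist_eq_norm]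
  exact (Metric.mem_ball.1 hy).le

/-- An element killed by `p ^ k` is the image of `1` under a continuous homomorphism
from `ℤ_[p]` whose values are powers of that element. -/
theorem exists_continuous_monoidHom_of_pow_eq_one {G : Type*} [Group G] [TopologicalSpace G]
    {g : G} {k : ℕ} (hg : g ^ p ^ k = 1) :
    ∃ φ : Multiplicative ℤ_[p] →* G, Continuous φ ∧ φ (Multiplicative.ofAdd 1) = g ∧
      ∀ x, φ x ∈ Subgroup.zpowers g := by
  let ψ : ZMod (p ^ k) →+ Additive G :=
    ZMod.lift (p ^ k) ⟨zmultiplesHom _ (Additive.ofMul g), by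
      rw [zmultiplesHom_apply, natCast_zsmul, ← ofMul_pow, hg, ofMul_one]⟩
  have hψ (m : ℤ) : (ψ m).toMul = g ^ m := by simp [ψ]
  refine ⟨(ψ.comp (toZModPow k).toAddMonoidHom).toMultiplicativeLeft, ?_, ?_, fun x ↦ ?_⟩
  · exact ((isLocallyConstant_toZModPow k).comp fun z ↦ (ψ z).toMul).continuous
  · simpa using hψ 1
  · obtain ⟨m, hm⟩ := ZMod.intCast_surjective (toZModPow k x.toAdd)
    exact ⟨m, by simp [← hψ, hm]⟩

theorem monoidHom_ext {M : Type*} [Monoid M] [TopologicalSpace M] [T2Space M]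
    {φ ψ : Multiplicative ℤ_[p] →* M} (hφ : Continuous φ) (hψ : Continuous ψ)
    (h : φ (Multiplicative.ofAdd 1) = ψ (Multiplicative.ofAdd 1)) : φ = ψ := by
  refine MonoidHom.ext fun x ↦ congrFun
    ((denseRange_natCast (p := p)).equalizer (g := fun x : ℤ_[p] ↦ φ (Multiplicative.ofAdd x))
      (h := fun x : ℤ_[p] ↦ ψ (Multiplicative.ofAdd x)) hφ hψ ?_) x.toAdd
  funext m
  have hm : Multiplicative.ofAdd (m : ℤ_[p]) = Multiplicative.ofAdd 1 ^ m := by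
    rw [← ofAdd_nsmul, nsmul_one]
  simp [hm, h]

theorem exists_orderOf_eq_pow {G : Type*} [Group G] [TopologicalSpace G] [DiscreteTopology G]
    {φ : Multiplicative ℤ_[p] →* G} (hφ : Continuous φ) (x : Multiplicative ℤ_[p]) :
    ∃ k : ℕ, orderOf (φ x) = p ^ k := by
  have hp : Filter.Tendsto (fun k : ℕ ↦ (p : ℤ_[p]) ^ k * x.toAdd) Filter.atTop (nhds 0) := by
    have hlt : ‖(p : ℤ_[p])‖ < 1 :=
      norm_p (p := p) ▸ inv_lt_one_of_one_lt₀ (by exact_mod_cast (Fact.out : p.Prime).one_lt)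
    simpa using (tendsto_pow_atTop_nhds_zero_of_norm_lt_one hlt).mul_const x.toAdd
  have h := (hφ.tendsto (Multiplicative.ofAdd 0)).comp hp
  rw [ofAdd_zero, map_one, nhds_discrete, Filter.tendsto_pure] at h
  obtain ⟨k, hk⟩ := h.exists
  have hx : (φ x) ^ p ^ k = 1 := by
    rw [← map_pow, ← hk]
    refine congrArg φ (Multiplicative.toAdd.injective ?_)
    change p ^ k • x.toAdd = (p : ℤ_[p]) ^ k * x.toAdd
    simp
  obtain ⟨m, -, hm⟩ := (Nat.dvd_prime_pow Fact.out).1 (orderOf_dvd_of_pow_eq_one hx)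
  exact ⟨m, hm⟩

end PadicInt

theorem MonoidHom.continuous_noncommPiCoprod {ι M : Type*} [Fintype ι] {N : ι → Type*}
    [∀ i, Monoid (N i)] [∀ i, TopologicalSpace (N i)] [Monoid M] [TopologicalSpace M]
    [ContinuousMul M] (φ : ∀ i, N i →* M)
    (hcomm : Pairwise fun i j ↦ ∀ x y, Commute (φ i x) (φ j y)) (hφ : ∀ i, Continuous (φ i)) :
    Continuous (MonoidHom.noncommPiCoprod φ hcomm) := by
  classical
  have key (s : Finset ι) : Continuous fun f : ∀ i, N i ↦
      s.noncommProd (fun i ↦ φ i (f i)) fun _ _ _ _ h ↦ hcomm h _ _ := by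
    induction s using Finset.induction_on with
    | empty => exact continuous_const.congr fun _ ↦ (Finset.noncommProd_empty _ _).symm
    | insert i s hi ih =>
      exact (((hφ i).comp (continuous_apply i)).mul ih).congr fun f ↦
        (Finset.noncommProd_insert_of_notMem s i (fun i ↦ φ i (f i)) _ hi).symm
  exact key Finset.univ

/-- For a prime `p`, `n ≥ 0`, and a finite group `G` with the discrete topology,
evaluation on the standard basis vectors is a `G`-equivariant bijection between
continuous homomorphisms `ℤₚⁿ → G` (with `ℤₚⁿ` written multiplicatively) and commuting
`n`-tuples in `G` all of whose entries have `p`-power order; here `G` acts on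
homomorphisms by postcomposition with conjugation and on tuples by simultaneous
conjugation. -/
theorem continuous_hom_padic_pow_equiv_comm_tuples (p : ℕ) [Fact p.Prime] (n : ℕ)
    (G : Type*) [Group G] [Finite G] [TopologicalSpace G] [DiscreteTopology G] :
    ∃ e : {f : Multiplicative (Fin n → ℤ_[p]) →* G // Continuous f} ≃
        {g : Fin n → G //
          (∀ i j, g i * g j = g j * g i) ∧ ∀ i, ∃ k : ℕ, orderOf (g i) = p ^ k},
      (∀ (f : {f : Multiplicative (Fin n → ℤ_[p]) →* G // Continuous f}) (i : Fin n),
        (e f : Fin n → G) i = f.1 (Multiplicative.ofAdd (Pi.single i (1 : ℤ_[p])))) ∧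
      ∀ (h : G) (f : {f : Multiplicative (Fin n → ℤ_[p]) →* G // Continuous f}),
        (e ⟨(MulAut.conj h).toMonoidHom.comp f.1,
            by rw [MonoidHom.coe_comp]; exact Continuous.comp continuous_of_discreteTopology f.2⟩ : Fin n → G)
          = fun i => h * (e f : Fin n → G) i * h⁻¹ := by
  let single (i : Fin n) : Multiplicative ℤ_[p] →* Multiplicative (Fin n → ℤ_[p]) :=
    (AddMonoidHom.single (fun _ ↦ ℤ_[p]) i).toMultiplicative
  have hsingle (i : Fin n) : Continuous (single i) :=
    continuous_single (A := fun _ : Fin n ↦ ℤ_[p]) i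
  let F (f : {f : Multiplicative (Fin n → ℤ_[p]) →* G // Continuous f}) :
      {g : Fin n → G //
        (∀ i j, g i * g j = g j * g i) ∧ ∀ i, ∃ k : ℕ, orderOf (g i) = p ^ k} :=
    ⟨fun i ↦ f.1 (Multiplicative.ofAdd (Pi.single i 1)),
      fun i j ↦ (Commute.all _ _).map f.1,
      fun i ↦ PadicInt.exists_orderOf_eq_pow (φ := f.1.comp (single i))
        (f.2.comp (hsingle i)) (Multiplicative.ofAdd 1)⟩
  have hF : Function.Bijective F := by
    constructor
    · intro f f' h
      have hcomp (i : Fin n) : f.1.comp (single i) = f'.1.comp (single i) :=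
        PadicInt.monoidHom_ext (f.2.comp (hsingle i)) (f'.2.comp (hsingle i))
          (congrFun (congrArg Subtype.val h) i)
      let e : Multiplicative (Fin n → ℤ_[p]) ≃* (Fin n → Multiplicative ℤ_[p]) :=
        MulEquiv.funMultiplicative _ _
      have hfe : f.1.comp e.symm.toMonoidHom = f'.1.comp e.symm.toMonoidHom :=
        MonoidHom.pi_ext fun i x ↦ DFunLike.congr_fun (hcomp i) x
      exact Subtype.ext (MonoidHom.ext fun x ↦ DFunLike.congr_fun hfe (e x))
    · rintro ⟨g, hcomm, hg⟩
      choose k hk using id hg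
      choose φ hφ hφ1 hφg using fun i ↦ PadicInt.exists_continuous_monoidHom_of_pow_eq_one
        (p := p) (hk i ▸ pow_orderOf_eq_one (g i))
      have hφcomm : Pairwise fun i j ↦ ∀ x y, Commute (φ i x) (φ j y) := by
        intro i j _ x y
        obtain ⟨a, ha⟩ := hφg i x
        obtain ⟨b, hb⟩ := hφg j y
        rw [← ha, ← hb]
        exact Commute.zpow_zpow (hcomm i j) a b
      refine ⟨⟨(MonoidHom.noncommPiCoprod φ hφcomm).comp
        (MulEquiv.funMultiplicative (Fin n) ℤ_[p]).toMonoidHom,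
        MonoidHom.continuous_noncommPiCoprod φ hφcomm hφ⟩, Subtype.ext (funext fun i ↦ ?_)⟩
      exact (MonoidHom.noncommPiCoprod_mulSingle (ϕ := φ) (hcomm := hφcomm) i
        (Multiplicative.ofAdd 1)).trans (hφ1 i)
  exact ⟨Equiv.ofBijective F hF, fun _ _ ↦ rfl, fun _ _ ↦ rfl⟩
end

section
/- Let G be a finite group with exponent m, and let f : G → ℂ be a class function (f(h g h⁻¹) = f(g) for all g, h). Then f is a ℚ-linear combination of characters of finite-dimensional complex representations of G if and only if: (i) every value f(g) lies in the cyclotomic field ℚ(ζ_m) ⊆ ℂ, and (ii) for every integer k coprime to m and every g ∈ G, f(gᵏ) = σₖ(f(g)), where σₖ is the automorphism of ℚ(ζ_m) sending every m-th root of unity ζ to ζᵏ. -/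
open scoped IntermediateField

/-- A linear map `T` with `T ^ m = 1` is diagonalizable with `m`-th roots of unity as eigenvalues,
so the traces of its powers are given by the multiplicities `d j` of the eigenvalues `ζ ^ j`. -/
theorem LinearMap.exists_trace_pow_eq_sum_of_pow_eq_one {K V : Type*} [Field K] [CharZero K]
    [AddCommGroup V] [Module K V] [FiniteDimensional K V] {m : ℕ} [NeZero m] {ζ : K}
    (hζ : IsPrimitiveRoot ζ m) (T : Module.End K V) (hT : T ^ m = 1) :
    ∃ d : ℕ → ℕ, ∀ n : ℕ,
      LinearMap.trace K V (T ^ n) = ∑ j ∈ Finset.range m, (d j : K) * (ζ ^ j) ^ n := by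
  have hm : (m : K) ≠ 0 := Nat.cast_ne_zero.2 (NeZero.ne m)
  have hζ0 : ζ ≠ 0 := hζ.ne_zero (NeZero.ne m)
  let e : ℕ → Module.End K V := fun j =>
    (m : K)⁻¹ • ∑ i ∈ Finset.range m, ((ζ ^ j)⁻¹) ^ i • T ^ i
  have hTe (j : ℕ) : T * e j = ζ ^ j • e j := by
    have hj : ζ ^ j ≠ 0 := pow_ne_zero _ hζ0
    have key : ∑ i ∈ Finset.range m, ((ζ ^ j)⁻¹) ^ (i + 1) • T ^ (i + 1) =
        ∑ i ∈ Finset.range m, ((ζ ^ j)⁻¹) ^ i • T ^ i := by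
      have h : ∀ u : ℕ → Module.End K V, ∑ i ∈ Finset.range m, u (i + 1) + u 0 =
          ∑ i ∈ Finset.range m, u i + u m := fun u => by
        rw [← Finset.sum_range_succ', Finset.sum_range_succ]
      specialize h fun i => ((ζ ^ j)⁻¹) ^ i • T ^ i
      have hjm : ((ζ ^ j)⁻¹) ^ m = 1 := by
        rw [inv_pow, ← pow_mul, mul_comm, pow_mul, hζ.pow_eq_one, one_pow, inv_one]
      simpa [hjm, hT] using h
    simp only [e]
    rw [mul_smul_comm, smul_comm (ζ ^ j) (m : K)⁻¹]
    congr 1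
    conv_rhs => rw [← key]
    rw [Finset.mul_sum, Finset.smul_sum]
    refine Finset.sum_congr rfl fun i _ => ?_
    rw [mul_smul_comm, smul_smul, pow_succ' T, pow_succ' (ζ ^ j)⁻¹, ← mul_assoc,
      mul_inv_cancel₀ hj, one_mul]
  have hTpow (n j : ℕ) : T ^ n * e j = (ζ ^ j) ^ n • e j := by
    induction n with
    | zero => simp
    | succ n ih => rw [pow_succ, mul_assoc, hTe, mul_smul_comm, ih, smul_smul, pow_succ']
  have hidem (j : ℕ) : IsIdempotentElem (e j) := by
    have hj : ζ ^ j ≠ 0 := pow_ne_zero _ hζ0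
    change ((m : K)⁻¹ • ∑ i ∈ Finset.range m, ((ζ ^ j)⁻¹) ^ i • T ^ i) * e j = e j
    simp only [smul_mul_assoc, Finset.sum_mul, hTpow, smul_smul, ← mul_pow,
      inv_mul_cancel₀ hj, one_pow, one_smul, Finset.sum_const, Finset.card_range]
    rw [← Nat.cast_smul_eq_nsmul K, smul_smul, inv_mul_cancel₀ hm, one_smul]
  have hsum : ∑ j ∈ Finset.range m, e j = 1 := by
    simp only [e]
    rw [← Finset.smul_sum, Finset.sum_comm]
    simp only [← Finset.sum_smul]
    rw [Finset.sum_eq_single_of_mem 0 (Finset.mem_range.2 (NeZero.pos m))]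
    · simp [smul_smul, hm, ← Nat.cast_smul_eq_nsmul K]
    · intro i hi hi0
      have hne : ζ⁻¹ ^ i ≠ 1 := hζ.inv.pow_ne_one_of_pos_of_lt hi0 (Finset.mem_range.1 hi)
      have h := mul_neg_geom_sum (ζ⁻¹ ^ i) m
      rw [← pow_mul, mul_comm i, pow_mul, hζ.inv.pow_eq_one, one_pow, sub_self] at h
      have h0 := (mul_eq_zero.1 h).resolve_left (sub_ne_zero.2 hne.symm)
      rw [← zero_smul K (T ^ i), ← h0]
      congr 1
      refine Finset.sum_congr rfl fun j _ => ?_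
      rw [← inv_pow, ← pow_mul, ← pow_mul, mul_comm]
  refine ⟨fun j => Module.finrank K (LinearMap.range (e j)), fun n => ?_⟩
  rw [← mul_one (T ^ n), ← hsum, Finset.mul_sum, map_sum]
  refine Finset.sum_congr rfl fun j _ => ?_
  rw [hTpow, map_smul, (LinearMap.IsIdempotentElem.isProj_range _ (hidem j)).trace, smul_eq_mul, mul_comm]

/-- A linear functional on matrices invariant under cyclic permutations is a multiple of the
trace. -/
theorem Matrix.exists_eq_mul_trace_of_map_mul_comm {R n : Type*} [CommRing R] [Fintype n]
    [DecidableEq n] (τ : Matrix n n R →ₗ[R] R) (hτ : ∀ A B, τ (A * B) = τ (B * A)) :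
    ∃ c : R, ∀ A, τ A = c * A.trace := by
  rcases isEmpty_or_nonempty n with hn | ⟨⟨i₀⟩⟩
  · exact ⟨0, fun A => by rw [Subsingleton.elim A 0]; simp⟩
  refine ⟨τ (Matrix.single i₀ i₀ 1), fun A => ?_⟩
  have hE (i j : n) : τ (Matrix.single i j 1) =
      if i = j then τ (Matrix.single i₀ i₀ 1) else 0 := by
    have h := hτ (Matrix.single i i₀ 1) (Matrix.single i₀ j 1)
    rw [Matrix.single_mul_single_same, mul_one] at h
    rw [h]
    split_ifs with hij
    · subst hij
      rw [Matrix.single_mul_single_same, mul_one]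
    · rw [Matrix.single_mul_single_of_ne _ _ _ _ (Ne.symm hij), map_zero]
  generalize τ (Matrix.single i₀ i₀ 1) = c at hE ⊢
  conv_lhs => rw [Matrix.matrix_eq_sum_single A]
  have hs (i j : n) : Matrix.single i j (A i j) = A i j • Matrix.single i j (1 : R) := by
    rw [Matrix.smul_single, smul_eq_mul, mul_one]
  simp only [hs, map_sum, map_smul, hE, smul_eq_mul, mul_ite, mul_zero,
    Finset.sum_ite_eq, Finset.mem_univ, if_true, Matrix.trace, Matrix.diag_apply, Finset.mul_sum]
  exact Finset.sum_congr rfl fun i _ => mul_comm _ _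

/-- A linear functional on a finite product of matrix algebras invariant under cyclic permutations
is a linear combination of the traces of the factors. -/
theorem Matrix.exists_eq_sum_mul_trace_of_map_mul_comm {R ι : Type*} [CommRing R] [Fintype ι]
    [DecidableEq ι] {n : ι → Type*} [∀ i, Fintype (n i)] [∀ i, DecidableEq (n i)]
    (τ : (∀ i, Matrix (n i) (n i) R) →ₗ[R] R) (hτ : ∀ A B, τ (A * B) = τ (B * A)) :
    ∃ c : ι → R, ∀ A, τ A = ∑ i, c i * (A i).trace := by
  have h (i : ι) := Matrix.exists_eq_mul_trace_of_map_mul_comm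
    (τ ∘ₗ LinearMap.single R (fun i => Matrix (n i) (n i) R) i) fun A B => by
      simp only [LinearMap.comp_apply, LinearMap.single_apply, Pi.single_mul, hτ]
  choose c hc using h
  refine ⟨c, fun A => ?_⟩
  conv_lhs => rw [← Finset.univ_sum_single A]
  rw [map_sum]
  exact Finset.sum_congr rfl fun i _ => hc i (A i)

/-- Every class function on a finite group is a `ℂ`-linear combination of characters. -/
theorem FDRep.exists_eq_sum_mul_character (G : Type) [Group G] [Finite G] (f : G → ℂ)
    (hf : ∀ g h : G, f (h * g * h⁻¹) = f g) :
    ∃ (N : ℕ) (c : Fin N → ℂ) (V : Fin N → FDRep ℂ G),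
      ∀ g : G, f g = ∑ i, c i * (V i).character g := by
  have : NeZero (Nat.card G : ℂ) := ⟨Nat.cast_ne_zero.2 Nat.card_pos.ne'⟩
  obtain ⟨N, d, -, ⟨e⟩⟩ :=
    IsSemisimpleRing.exists_algEquiv_pi_matrix_of_isAlgClosed ℂ (MonoidAlgebra ℂ G)
  let τ : MonoidAlgebra ℂ G →ₗ[ℂ] ℂ := (MonoidAlgebra.basis G ℂ).constr ℂ f
  have hτ_of (g : G) : τ (MonoidAlgebra.of ℂ G g) = f g := by
    have h := (MonoidAlgebra.basis G ℂ).constr_basis ℂ f g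
    simpa using h
  have hτ (a b : MonoidAlgebra ℂ G) : τ (a * b) = τ (b * a) := by
    induction a using MonoidAlgebra.induction_on with
    | of g =>
      induction b using MonoidAlgebra.induction_on with
      | of h =>
        rw [← map_mul, ← map_mul, hτ_of, hτ_of, ← hf (g * h) g⁻¹]
        congr 1
        group
      | add x y hx hy => rw [mul_add, add_mul, map_add, map_add, hx, hy]
      | smul r x hx => rw [mul_smul_comm, smul_mul_assoc, map_smul, map_smul, hx]
    | add x y hx hy => rw [mul_add, add_mul, map_add, map_add, hx, hy]
    | smul r x hx => rw [mul_smul_comm, smul_mul_assoc, map_smul, map_smul, hx]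
  obtain ⟨c, hc⟩ := Matrix.exists_eq_sum_mul_trace_of_map_mul_comm
    (τ ∘ₗ e.symm.toLinearMap) fun A B => by simp [hτ]
  let ρ (i : Fin N) : Representation ℂ G (Fin (d i) → ℂ) :=
    (Matrix.toLinAlgEquiv' : _ ≃ₐ[ℂ] _).toMonoidHom.comp
      (((Pi.evalRingHom _ i).comp e.toRingHom).toMonoidHom.comp (MonoidAlgebra.of ℂ G))
  refine ⟨N, c, fun i => FDRep.of (ρ i), fun g => ?_⟩
  have h := hc (e (MonoidAlgebra.of ℂ G g))
  simp only [LinearMap.comp_apply, AlgEquiv.toLinearMap_apply, AlgEquiv.symm_apply_apply,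
    hτ_of] at h
  rw [h]
  refine Finset.sum_congr rfl fun i _ => ?_
  congr 1
  exact (Matrix.trace_toLin'_eq _).symm

/-- The characters of a finite group of exponent `m` take values in `ℚ(ζ_m)`, and the Galois action
on their values is given by taking powers in the group. -/
theorem FDRep.exists_character_eq_cyclotomic {G : Type} [Group G] {m : ℕ} [NeZero m]
    (hG : ∀ g : G, g ^ m = 1) {ζ : ℂ} (hζ : IsPrimitiveRoot ζ m) (V : FDRep ℂ G) :
    ∃ χ : G → ℚ⟮ζ⟯,
      (∀ g, (χ g : ℂ) = V.character g) ∧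
      ∀ (n : ℕ) (σ : ℚ⟮ζ⟯ ≃ₐ[ℚ] ℚ⟮ζ⟯),
        (σ (IntermediateField.AdjoinSimple.gen ℚ ζ) : ℂ) = ζ ^ n →
          ∀ g, χ (g ^ n) = σ (χ g) := by
  have h (g : G) := LinearMap.exists_trace_pow_eq_sum_of_pow_eq_one hζ (V.ρ g)
    (by rw [← map_pow, hG, map_one])
  choose d hd using h
  let χ : G → ℚ⟮ζ⟯ := fun g =>
    ∑ j ∈ Finset.range m, (d g j : ℚ⟮ζ⟯) *
      IntermediateField.AdjoinSimple.gen ℚ ζ ^ j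
  have hχ (g : G) : (χ g : ℂ) = V.character g := by
    have h := hd g 1
    simp only [pow_one] at h
    rw [FDRep.character, h]
    simp [χ]
  refine ⟨χ, hχ, fun n σ hσ g => Subtype.ext ?_⟩
  rw [hχ, FDRep.character, map_pow, hd]
  simp only [χ, map_sum, map_mul, map_natCast, map_pow]
  simp [hσ, ← pow_mul, mul_comm n]

/-- An integer power of an element of order dividing `m` is a natural power, with an exponent
that depends only on `m`. -/
theorem zpow_eq_pow_toNat_emod {G : Type*} [Group G] {m : ℕ} [NeZero m] {x : G}
    (hx : x ^ m = 1) (k : ℤ) : x ^ k = x ^ (k % m).toNat := by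
  rw [← zpow_natCast, Int.toNat_of_nonneg (Int.emod_nonneg _ (by exact_mod_cast NeZero.ne m))]
  exact zpow_eq_zpow_emod k (by simpa using hx)

/-- A function with values in `ℚ(ζ_m)` on which the Galois group acts by taking powers is a
`ℚ`-linear combination of characters if it is a `ℂ`-linear combination of characters. -/
theorem FDRep.exists_eq_sum_rat_mul_character {G : Type} [Group G] {m : ℕ} [NeZero m]
    (hG : ∀ g : G, g ^ m = 1) {ζ : ℂ} (hζ : IsPrimitiveRoot ζ m)
    (f : G → ℚ⟮ζ⟯) (hf : ∀ (n : ℕ) (σ : ℚ⟮ζ⟯ ≃ₐ[ℚ] ℚ⟮ζ⟯), n.Coprime m →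
      (σ (IntermediateField.AdjoinSimple.gen ℚ ζ) : ℂ) = ζ ^ n → ∀ g, f (g ^ n) = σ (f g))
    {ι : Type*} [Fintype ι] (c : ι → ℂ) (V : ι → FDRep ℂ G)
    (hfc : ∀ g, (f g : ℂ) = ∑ i, c i * (V i).character g) :
    ∃ q : ι → ℚ, ∀ g, (f g : ℂ) = ∑ i, (q i : ℂ) * (V i).character g := by
  let z : ℚ⟮ζ⟯ := IntermediateField.AdjoinSimple.gen ℚ ζ
  have hz : IsPrimitiveRoot z m := IsPrimitiveRoot.coe_submonoidClass_iff.1 hζ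
  have : IsCyclotomicExtension {m} ℚ ℚ⟮ζ⟯ := by
    change IsCyclotomicExtension {m} ℚ ℚ⟮ζ⟯.toSubalgebra
    rw [IntermediateField.adjoin_simple_toSubalgebra_of_isAlgebraic
      (hζ.isIntegral (NeZero.pos m)).tower_top.isAlgebraic]
    exact hζ.adjoin_isCyclotomicExtension ℚ
  have : FiniteDimensional ℚ ℚ⟮ζ⟯ := IsCyclotomicExtension.finiteDimensional {m} ℚ ℚ⟮ζ⟯
  have : IsGalois ℚ ℚ⟮ζ⟯ := IsCyclotomicExtension.isGalois {m} ℚ ℚ⟮ζ⟯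
  choose χ hχ hσχ using fun i => FDRep.exists_character_eq_cyclotomic hG hζ (V i)
  obtain ⟨π, hπ⟩ := (Algebra.linearMap ℚ⟮ζ⟯ ℂ).exists_leftInverse_of_injective
    (LinearMap.ker_eq_bot.2 (algebraMap ℚ⟮ζ⟯ ℂ).injective)
  have hπ_coe (x : ℚ⟮ζ⟯) : π (x : ℂ) = x := LinearMap.congr_fun hπ x
  have hfπ (g : G) : f g = ∑ i, π (c i) * χ i g := by
    rw [← hπ_coe (f g), hfc, map_sum]
    refine Finset.sum_congr rfl fun i _ => ?_
    rw [← hχ, mul_comm, mul_comm (π _)]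
    exact π.map_smul (χ i g) (c i)
  have hfσ (σ : ℚ⟮ζ⟯ ≃ₐ[ℚ] ℚ⟮ζ⟯) (g : G) : f g = ∑ i, σ (π (c i)) * χ i g := by
    obtain ⟨n, -, hn, hσ⟩ := hz.isPrimitiveRoot_iff.1 (hz.map_of_injective σ.injective)
    have hσ' : (σ z : ℂ) = ζ ^ n := by rw [← hσ]; rfl
    obtain ⟨l, hl⟩ := exists_pow_eq_self_of_coprime
      (hn.coprime_dvd_right (orderOf_dvd_of_pow_eq_one (hG g)))
    rw [pow_right_comm] at hl
    rw [← hl, hf n σ hn hσ', hfπ, map_sum]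
    refine Finset.sum_congr rfl fun i _ => ?_
    rw [map_mul, hσχ i n σ hσ']
  refine ⟨fun i => Algebra.trace ℚ ℚ⟮ζ⟯ (π (c i)) / Fintype.card (ℚ⟮ζ⟯ ≃ₐ[ℚ] ℚ⟮ζ⟯), fun g => ?_⟩
  have hcard : (Fintype.card (ℚ⟮ζ⟯ ≃ₐ[ℚ] ℚ⟮ζ⟯) : ℚ⟮ζ⟯) ≠ 0 :=
    Nat.cast_ne_zero.2 Fintype.card_ne_zero
  have hsum : (Fintype.card (ℚ⟮ζ⟯ ≃ₐ[ℚ] ℚ⟮ζ⟯) : ℚ⟮ζ⟯) * f g =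
      ∑ i, (Algebra.trace ℚ ℚ⟮ζ⟯ (π (c i)) : ℚ⟮ζ⟯) * χ i g := by
    have h := Finset.sum_congr (rfl : (Finset.univ : Finset (ℚ⟮ζ⟯ ≃ₐ[ℚ] ℚ⟮ζ⟯)) = _)
      fun σ _ => hfσ σ g
    rw [Finset.sum_const, Finset.card_univ, nsmul_eq_mul, Finset.sum_comm] at h
    rw [h]
    refine Finset.sum_congr rfl fun i _ => ?_
    rw [← Finset.sum_mul, ← trace_eq_sum_automorphisms, eq_ratCast]
  have hq : f g = ∑ i, ((Algebra.trace ℚ ℚ⟮ζ⟯ (π (c i)) / Fintype.card (ℚ⟮ζ⟯ ≃ₐ[ℚ] ℚ⟮ζ⟯) : ℚ) :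
      ℚ⟮ζ⟯) * χ i g := by
    rw [← mul_right_inj' hcard, hsum, Finset.mul_sum]
    refine Finset.sum_congr rfl fun i _ => ?_
    push_cast
    field_simp
  rw [hq]
  push_cast
  simp only [hχ]

/-- Artin's theorem: for a finite group `G` of exponent `m` and a class function
`f : G → ℂ`, `f` is a `ℚ`-linear combination of characters of finite-dimensional complex
representations of `G` if and only if (i) all values of `f` lie in the cyclotomic field
`ℚ(ζ_m) ⊆ ℂ`, and (ii) for every integer `k` coprime to `m`, every `g ∈ G`, and the
automorphism `σₖ` of `ℚ(ζ_m)` sending each `m`-th root of unity `ζ` to `ζᵏ`, one has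
`f(gᵏ) = σₖ(f(g))`. -/
theorem artin_rational_class_functions (G : Type) [Group G] [Finite G]
    (m : ℕ) (hm : Monoid.exponent G = m) (ζ : ℂ) (hζ : IsPrimitiveRoot ζ m)
    (f : G → ℂ) (hf : ∀ g h : G, f (h * g * h⁻¹) = f g) :
    (∃ (N : ℕ) (c : Fin N → ℚ) (V : Fin N → FDRep ℂ G),
      ∀ g : G, f g = ∑ i, (c i : ℂ) * (V i).character g) ↔
    ∃ hi : ∀ g : G, f g ∈ IntermediateField.adjoin ℚ ({ζ} : Set ℂ),
      ∀ k : ℤ, Int.gcd k m = 1 →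
        ∀ σ : (IntermediateField.adjoin ℚ ({ζ} : Set ℂ)) ≃ₐ[ℚ]
            (IntermediateField.adjoin ℚ ({ζ} : Set ℂ)),
          (∀ z : IntermediateField.adjoin ℚ ({ζ} : Set ℂ),
            (z : ℂ) ^ m = 1 → (σ z : ℂ) = (z : ℂ) ^ k) →
          ∀ g : G, f (g ^ k) = (σ ⟨f g, hi g⟩ : ℂ) := by
  have : NeZero m := ⟨hm ▸ Monoid.exponent_ne_zero_of_finite⟩
  have hG (g : G) : g ^ m = 1 := hm ▸ Monoid.pow_exponent_eq_one g
  have hζu : (hζ.isUnit (NeZero.ne m)).unit ^ m = 1 := Units.ext (by simpa using hζ.pow_eq_one)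
  have hζz (k : ℤ) : ζ ^ k = ζ ^ (k % m).toNat := by
    simpa using congrArg Units.val (zpow_eq_pow_toNat_emod hζu k)
  constructor
  · rintro ⟨N, c, V, hV⟩
    choose χ hχ hσχ using fun i => FDRep.exists_character_eq_cyclotomic hG hζ (V i)
    have hfχ (g : G) : f g = ((∑ i, (c i : ℚ⟮ζ⟯) * χ i g : ℚ⟮ζ⟯) : ℂ) := by
      simp [hV, hχ]
    refine ⟨fun g => hfχ g ▸ SetLike.coe_mem _, fun k _ σ hσ g => ?_⟩
    have hgen := (hσ (IntermediateField.AdjoinSimple.gen ℚ ζ) hζ.pow_eq_one).trans (hζz k)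
    rw [hfχ, zpow_eq_pow_toNat_emod (hG g)]
    congr 1
    rw [show (⟨f g, _⟩ : ℚ⟮ζ⟯) = _ from Subtype.ext (hfχ g), map_sum]
    refine Finset.sum_congr rfl fun i _ => ?_
    rw [map_mul, map_ratCast, hσχ i _ σ hgen]
  · rintro ⟨hi, hσ⟩
    obtain ⟨N, c, V, hV⟩ := FDRep.exists_eq_sum_mul_character G f hf
    have hfσ (n : ℕ) (σ : ℚ⟮ζ⟯ ≃ₐ[ℚ] ℚ⟮ζ⟯) (hn : n.Coprime m)
        (hσn : (σ (IntermediateField.AdjoinSimple.gen ℚ ζ) : ℂ) = ζ ^ n) (g : G) :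
        (⟨f (g ^ n), hi (g ^ n)⟩ : ℚ⟮ζ⟯) = σ ⟨f g, hi g⟩ := by
      have hroot (z : ℚ⟮ζ⟯) (hz : (z : ℂ) ^ m = 1) : (σ z : ℂ) = (z : ℂ) ^ (n : ℤ) := by
        obtain ⟨j, -, hj⟩ := hζ.eq_pow_of_pow_eq_one hz
        obtain rfl : IntermediateField.AdjoinSimple.gen ℚ ζ ^ j = z := Subtype.ext hj
        simp [hσn, ← pow_mul, mul_comm j]
      have h := hσ n (by simpa using hn) σ hroot g
      rw [zpow_natCast] at h
      exact Subtype.ext h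
    obtain ⟨q, hq⟩ := FDRep.exists_eq_sum_rat_mul_character hG hζ (fun g => ⟨f g, hi g⟩)
      hfσ c V hV
    exact ⟨N, q, V, hq⟩
end
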